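/- arXiv:2003.08319 — 2 statements merged into one kernel-verified Lean document; each statement's English description precedes it below -/
import Mathlib

section
/- Let (ξ_n)_{n≥1} be a sequence of real numbers and let z_n = √n · e^{2πi ξ_n} ∈ ℂ. If (ξ_n) is uniformly distributed mod 1, then the sequence (z_n) has asymptotic density π⁻¹. -/
open Filter Topology MeasureTheory

/-- The point `z_n = √n · e^{2πi ξ_n}` in the complex plane. -/
noncomputable def zseq (ξ : ℕ → ℝ) (n : ℕ) : ℂ :=
  (Real.sqrt n : ℂ) * Complex.exp (2 * Real.pi * Complex.I * (ξ n : ℂ))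

/-- A sequence of reals is uniformly distributed mod 1: for all `a < b` with
`b - a ≤ 1`, the proportion of `n ≤ N` with `ξ n ∈ [a, b) + ℤ` tends to `b - a`. -/
def UnifDistMod1 (ξ : ℕ → ℝ) : Prop :=
  ∀ a b : ℝ, a < b → b - a ≤ 1 →
    Tendsto
      (fun N : ℕ =>
        ({n : ℕ | 1 ≤ n ∧ n ≤ N ∧ ∃ k : ℤ, a ≤ ξ n - k ∧ ξ n - k < b}.ncard : ℝ) / N)
      atTop (𝓝 (b - a))

/-- A sequence of complex numbers has asymptotic density `ρ`: for every bounded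
`B ⊆ ℂ` whose topological boundary is Lebesgue-null,
`#{n : z n ∈ R·B} / R² → ρ · vol B` as `R → ∞`. -/
def HasAsympDensity (z : ℕ → ℂ) (ρ : ℝ) : Prop :=
  ∀ B : Set ℂ, Bornology.IsBounded B → volume (frontier B) = 0 →
    Tendsto
      (fun R : ℝ =>
        ({n : ℕ | 1 ≤ n ∧ z n ∈ (fun w : ℂ => (R : ℂ) * w) '' B}.ncard : ℝ) / R ^ 2)
      atTop (𝓝 (ρ * (volume B).toReal))


namespace UDD

lemma exists_pm {Ω : Type*} [MeasurableSpace Ω] [MeasurableSingletonClass Ω] (N : ℕ) (hN : 1 ≤ N)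
    (p : ℕ → Ω) : ∃ μ : ProbabilityMeasure Ω, ∀ E : Set Ω,
      (μ : Measure Ω).real E = ({n : ℕ | 1 ≤ n ∧ n ≤ N ∧ p n ∈ E}.ncard : ℝ) / N := by
  classical
  let m : Measure Ω := (N : ENNReal)⁻¹ • ∑ n ∈ Finset.Icc 1 N, Measure.dirac (p n)
  have hm : ∀ E, m E = (N : ENNReal)⁻¹ * ((Finset.Icc 1 N).filter (fun n => p n ∈ E)).card := by
    intro E
    simp [m, Measure.dirac_apply, Set.indicator_apply]
  have hN0 : (N : ENNReal) ≠ 0 := by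
    simp; omega
  refine ⟨⟨m, ⟨?_⟩⟩, fun E => ?_⟩
  · rw [hm]
    simp
    exact ENNReal.inv_mul_cancel hN0 (by simp)
  · have : {n : ℕ | 1 ≤ n ∧ n ≤ N ∧ p n ∈ E} = ((Finset.Icc 1 N).filter (fun n => p n ∈ E) : Finset ℕ) := by
      ext n; simp [and_assoc]
    rw [this, Set.ncard_coe_finset]
    simp only [ProbabilityMeasure.coe_mk, Measure.real, hm]
    simp [ENNReal.toReal_mul, div_eq_inv_mul]

/-- representative in [-1/2, 1/2) -/
noncomputable def th (ξ : ℕ → ℝ) (n : ℕ) : ℝ := Int.fract (ξ n + 1/2) - 1/2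

lemma th_mem (ξ : ℕ → ℝ) (n : ℕ) : -(1/2) ≤ th ξ n ∧ th ξ n < 1/2 := by
  have h1 := Int.fract_nonneg (ξ n + 1/2)
  have h2 := Int.fract_lt_one (ξ n + 1/2)
  unfold th
  constructor <;> linarith

lemma th_eq (ξ : ℕ → ℝ) (n : ℕ) : th ξ n = ξ n - (⌊ξ n + 1/2⌋ : ℝ) := by
  unfold th Int.fract; ring

lemma th_iff (ξ : ℕ → ℝ) (n : ℕ) (c d : ℝ) (hc : -(1/2) ≤ c) (hd : d ≤ 1/2) :
    (∃ k : ℤ, c ≤ ξ n - k ∧ ξ n - k < d) ↔ th ξ n ∈ Set.Ico c d := by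
  constructor
  · rintro ⟨k, h1, h2⟩
    have : ⌊ξ n + 1/2⌋ = k := by
      rw [Int.floor_eq_iff]
      constructor <;> linarith
    rw [th_eq, this]
    exact ⟨h1, h2⟩
  · intro h
    rw [th_eq] at h
    exact ⟨_, h.1, h.2⟩

/-- counting -/
noncomputable def A (ξ : ℕ → ℝ) (c d : ℝ) (N : ℕ) : ℕ :=
  {n : ℕ | 1 ≤ n ∧ n ≤ N ∧ th ξ n ∈ Set.Ico c d}.ncard

lemma A_tendsto (ξ : ℕ → ℝ) (H : UnifDistMod1 ξ) (c d : ℝ) (hc : -(1/2) ≤ c) (hd : d ≤ 1/2)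
    (hcd : c < d) : Tendsto (fun N : ℕ => (A ξ c d N : ℝ) / N) atTop (𝓝 (d - c)) := by
  have := H c d hcd (by linarith)
  simp only [th_iff ξ _ c d hc hd] at this
  exact this

lemma A_floor (ξ : ℕ → ℝ) (H : UnifDistMod1 ξ) (c d : ℝ) (hc : -(1/2) ≤ c) (hd : d ≤ 1/2)
    (hcd : c < d) (b : ℝ) (hb : 0 ≤ b) :
    Tendsto (fun x : ℝ => (A ξ c d ⌊b * x⌋₊ : ℝ) / x) atTop (𝓝 (b * (d - c))) := by
  rcases hb.eq_or_lt with rfl | hb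
  · have : A ξ c d 0 = 0 := by
      unfold A
      rw [Set.ncard_eq_zero ((Set.finite_Icc 1 0).subset (fun n hn => ⟨hn.1, hn.2.1⟩))]
      ext n; simp; omega
    simp [this]
  · have h1 : Tendsto (fun x : ℝ => ⌊b * x⌋₊) atTop atTop :=
      tendsto_nat_floor_atTop.comp (tendsto_id.const_mul_atTop hb)
    have h2 := (A_tendsto ξ H c d hc hd hcd).comp h1
    have h3 := tendsto_nat_floor_mul_div_atTop (R := ℝ) hb.le
    have h4 := h3.mul h2
    refine h4.congr' ?_
    filter_upwards [h1.eventually_ge_atTop 1] with x hx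
    have : ((⌊b * x⌋₊ : ℕ) : ℝ) ≠ 0 := by
      have : ⌊b * x⌋₊ ≠ 0 := by omega
      exact_mod_cast this
    simp only [Function.comp]
    field_simp

/-- limit measure -/
noncomputable def nuM : Measure (ℝ × ℝ) :=
  ((volume : Measure ℝ).restrict (Set.Ioc 0 1)).prod
    ((volume : Measure ℝ).restrict (Set.Ico (-(1/2)) (1/2)))

instance : IsProbabilityMeasure nuM := by
  constructor
  rw [nuM, ← Set.univ_prod_univ, Measure.prod_prod]
  simp
  norm_num

lemma nuM_box (a b c d : ℝ) : nuM.real (Set.Ioc a b ×ˢ Set.Ico c d) =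
    max (min b 1 - max a 0) 0 * max (min d (1/2) - max c (-(1/2))) 0 := by
  rw [nuM, measureReal_prod_prod, measureReal_restrict_apply measurableSet_Ioc,
    measureReal_restrict_apply measurableSet_Ico, Set.Ioc_inter_Ioc, Set.Ico_inter_Ico,
    Real.volume_real_Ioc, Real.volume_real_Ico]

lemma box_count (ξ : ℕ → ℝ) (a b c d x : ℝ) (hx : 1 ≤ x)
    (hab : max a 0 ≤ min b 1) :
    ({n : ℕ | 1 ≤ n ∧ n ≤ ⌊x⌋₊ ∧ ((n : ℝ) / x, th ξ n) ∈ Set.Ioc a b ×ˢ Set.Ico c d}.ncard : ℝ) =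
     (A ξ (max c (-(1/2))) (min d (1/2)) ⌊min b 1 * x⌋₊ : ℝ)
      - A ξ (max c (-(1/2))) (min d (1/2)) ⌊max a 0 * x⌋₊ := by
  have hx0 : 0 < x := by linarith
  have hb0 : 0 ≤ min b 1 := le_trans (le_max_right _ _) hab
  have ha0 : 0 ≤ max a 0 := le_max_right _ _
  have hfin : ∀ N c d, {n : ℕ | 1 ≤ n ∧ n ≤ N ∧ th ξ n ∈ Set.Ico c d}.Finite :=
    fun N c d => (Set.finite_Icc 1 N).subset (fun n hn => ⟨hn.1, hn.2.1⟩)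
  have hle : ⌊max a 0 * x⌋₊ ≤ ⌊min b 1 * x⌋₊ := Nat.floor_mono (by gcongr)
  have hset : {n : ℕ | 1 ≤ n ∧ n ≤ ⌊x⌋₊ ∧
      ((n : ℝ) / x, th ξ n) ∈ Set.Ioc a b ×ˢ Set.Ico c d} =
      {n : ℕ | 1 ≤ n ∧ n ≤ ⌊min b 1 * x⌋₊ ∧ th ξ n ∈ Set.Ico (max c (-(1/2))) (min d (1/2))} \
      {n : ℕ | 1 ≤ n ∧ n ≤ ⌊max a 0 * x⌋₊ ∧ th ξ n ∈ Set.Ico (max c (-(1/2))) (min d (1/2))} := by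
    ext n
    have ht := th_mem ξ n
    simp only [Set.mem_ofPred_eq, Set.mem_sdiff, Set.mem_prod, Set.mem_Ioc, Set.mem_Ico,
      Nat.le_floor_iff hx0.le, Nat.le_floor_iff (mul_nonneg hb0 hx0.le),
      Nat.le_floor_iff (mul_nonneg ha0 hx0.le), ← div_le_iff₀ hx0, le_min_iff, max_le_iff,
      lt_min_iff, le_max_iff]
    have h1 : (n : ℝ) ≤ x ↔ (n : ℝ) / x ≤ 1 := by rw [div_le_one hx0]
    have h2 : 1 ≤ n → ¬ ((n : ℝ) / x ≤ 0) := by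
      intro h
      have : (0 : ℝ) < n := by exact_mod_cast h
      have := div_pos this hx0
      linarith
    rw [h1, ← not_le]
    tauto
  rw [hset, A, A, ← Set.ncard_sdiff_add_ncard_of_subset (s := {n : ℕ | 1 ≤ n ∧ n ≤ ⌊max a 0 * x⌋₊ ∧ th ξ n ∈ Set.Ico (max c (-(1/2))) (min d (1/2))}) (t := {n : ℕ | 1 ≤ n ∧ n ≤ ⌊min b 1 * x⌋₊ ∧ th ξ n ∈ Set.Ico (max c (-(1/2))) (min d (1/2))}) _ (hfin _ _ _)]
  · push_cast; ring
  · exact fun n hn => ⟨hn.1, hn.2.1.trans hle, hn.2.2⟩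

lemma box_tendsto (ξ : ℕ → ℝ) (H : UnifDistMod1 ξ) (a b c d : ℝ) :
    Tendsto (fun x : ℝ => ({n : ℕ | 1 ≤ n ∧ n ≤ ⌊x⌋₊ ∧
      ((n : ℝ) / x, th ξ n) ∈ Set.Ioc a b ×ˢ Set.Ico c d}.ncard : ℝ) / ⌊x⌋₊) atTop
      (𝓝 (nuM.real (Set.Ioc a b ×ˢ Set.Ico c d))) := by
  rw [nuM_box]
  by_cases hab : max a 0 ≤ min b 1
  · by_cases hcd : max c (-(1/2)) < min d (1/2)
    · rw [max_eq_left (a := min b 1 - max a 0) (by linarith),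
        max_eq_left (a := min d (1/2) - max c (-(1/2))) (by linarith)]
      have h1 := A_floor ξ H _ _ (le_max_right c _) (min_le_right d _) hcd (min b 1)
        ((le_max_right _ _).trans hab)
      have h2 := A_floor ξ H _ _ (le_max_right c _) (min_le_right d _) hcd (max a 0)
        (le_max_right _ _)
      have h3 := tendsto_nat_floor_div_atTop (R := ℝ)
      have h4 := (h1.sub h2).div h3 one_ne_zero
      rw [div_one, ← sub_mul] at h4
      refine h4.congr' ?_
      filter_upwards [eventually_ge_atTop 1] with x hx
      rw [box_count ξ a b c d x hx hab]
      have : (⌊x⌋₊ : ℝ) ≠ 0 := by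
        have := Nat.floor_pos.2 hx
        positivity
      simp only [Pi.sub_apply, Pi.div_apply]
      field_simp
    · rw [max_eq_right (a := min d (1/2) - _) (by linarith), mul_zero]
      refine tendsto_const_nhds.congr fun x => ?_
      rw [eq_comm, div_eq_zero_iff]
      left
      rw [Nat.cast_eq_zero]
      convert Set.ncard_empty ℕ using 2
      ext n
      have ht := th_mem ξ n
      simp only [Set.mem_ofPred_eq, Set.mem_prod, Set.mem_Ico, Set.mem_empty_iff_false, iff_false]
      rintro ⟨_, _, _, h⟩
      exact hcd ((max_le h.1 ht.1).trans_lt (lt_min h.2 ht.2))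
  · rw [max_eq_right (a := min b 1 - _) (by linarith), zero_mul]
    refine tendsto_const_nhds.congr' ?_
    filter_upwards [eventually_ge_atTop 1] with x hx
    rw [eq_comm, div_eq_zero_iff]
    left
    rw [Nat.cast_eq_zero]
    convert Set.ncard_empty ℕ using 2
    ext n
    simp only [Set.mem_ofPred_eq, Set.mem_prod, Set.mem_Ioc, Set.mem_empty_iff_false, iff_false]
    rintro ⟨h1, h2, h, _⟩
    have hx0 : 0 < x := by linarith
    rw [Nat.le_floor_iff hx0.le] at h2
    have : (n : ℝ) / x ≤ 1 := by rw [div_le_one hx0]; exact h2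
    have h0 : 0 ≤ (n : ℝ) / x := by positivity
    exact hab ((max_le h.1.le h0).trans (le_min h.2 this))

lemma count_tendsto (ξ : ℕ → ℝ) (H : UnifDistMod1 ξ) (E : Set (ℝ × ℝ))
    (hE : nuM (frontier E) = 0) :
    Tendsto (fun x : ℝ => ({n : ℕ | 1 ≤ n ∧ n ≤ ⌊x⌋₊ ∧
      ((n : ℝ) / x, th ξ n) ∈ E}.ncard : ℝ) / ⌊x⌋₊) atTop (𝓝 (nuM.real E)) := by
  have hex : ∀ x : ℝ, ∃ μ : ProbabilityMeasure (ℝ × ℝ), 1 ≤ x → ∀ E : Set (ℝ × ℝ),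
      (μ : Measure (ℝ × ℝ)).real E = ({n : ℕ | 1 ≤ n ∧ n ≤ ⌊x⌋₊ ∧
      ((n : ℝ) / x, th ξ n) ∈ E}.ncard : ℝ) / ⌊x⌋₊ := by
    intro x
    by_cases hx : 1 ≤ x
    · obtain ⟨μ, hμ⟩ := exists_pm ⌊x⌋₊ (Nat.floor_pos.2 hx) (fun n => ((n : ℝ) / x, th ξ n))
      exact ⟨μ, fun _ => hμ⟩
    · exact ⟨⟨nuM, inferInstance⟩, fun h => absurd h hx⟩
  choose μ hμ using hex
  let ν : ProbabilityMeasure (ℝ × ℝ) := ⟨nuM, inferInstance⟩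
  let S : Set (Set (ℝ × ℝ)) := {s | ∃ a b c d : ℝ, s = Set.Ioc a b ×ˢ Set.Ico c d}
  have hS : IsPiSystem S := by
    rintro _ ⟨a, b, c, d, rfl⟩ _ ⟨a', b', c', d', rfl⟩ _
    exact ⟨_, _, _, _, by rw [Set.prod_inter_prod, Set.Ioc_inter_Ioc, Set.Ico_inter_Ico]⟩
  have hlim : Tendsto μ atTop (𝓝 ν) := by
    refine hS.tendsto_probabilityMeasure_of_tendsto_of_mem ?_ ?_ ?_
    · rintro _ ⟨a, b, c, d, rfl⟩
      exact measurableSet_Ioc.prod measurableSet_Ico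
    · intro u hu x hx
      obtain ⟨s, hs, t, ht, hst⟩ := mem_nhds_prod_iff.1 (hu.mem_nhds hx)
      obtain ⟨a, b, h1, h2⟩ := mem_nhds_iff_exists_Ioo_subset.1 hs
      obtain ⟨c, d, h3, h4⟩ := mem_nhds_iff_exists_Ioo_subset.1 ht
      obtain ⟨b', hb1, hb2⟩ := exists_between h1.2
      obtain ⟨c', hc1, hc2⟩ := exists_between h3.1
      refine ⟨_, ⟨a, b', c', d, rfl⟩, prod_mem_nhds (Ioc_mem_nhds h1.1 hb1)
        (Ico_mem_nhds hc2 h3.2), ?_⟩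
      refine (Set.prod_mono (fun y hy => h2 ⟨hy.1, hy.2.trans_lt hb2⟩)
        (fun y hy => h4 ⟨hc1.trans_le hy.1, hy.2⟩)).trans hst
    · rintro _ ⟨a, b, c, d, rfl⟩
      rw [← NNReal.tendsto_coe]
      refine (box_tendsto ξ H a b c d).congr' ?_
      filter_upwards [eventually_ge_atTop 1] with x hx
      rw [← hμ x hx]
      rfl
  have := ProbabilityMeasure.tendsto_measure_of_null_frontier_of_tendsto' hlim (E := E) hE
  have h2 := (ENNReal.tendsto_toReal (measure_ne_top nuM E)).comp this
  refine h2.congr' ?_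
  filter_upwards [eventually_ge_atTop 1] with x hx
  rw [← hμ x hx]
  rfl

/-- polar map -/
noncomputable def g (C : ℝ) (p : ℝ × ℝ) : ℂ :=
  (C * Real.sqrt p.1 : ℝ) * Complex.exp (2 * Real.pi * Complex.I * (p.2 : ℂ))

lemma g_cont (C : ℝ) : Continuous (g C) := by
  unfold g; fun_prop

/-- inverse change of variables -/
noncomputable def jm (C : ℝ) (p : ℝ × ℝ) : ℝ × ℝ := (p.1 ^ 2 / C ^ 2, p.2 / (2 * Real.pi))

noncomputable def jd (C : ℝ) (p : ℝ × ℝ) : ℝ × ℝ →L[ℝ] ℝ × ℝ :=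
  (ContinuousLinearMap.toSpanSingleton ℝ (2 * p.1 / C ^ 2)).prodMap
    (ContinuousLinearMap.toSpanSingleton ℝ (1 / (2 * Real.pi)))

lemma jm_deriv (C : ℝ) (p : ℝ × ℝ) : HasFDerivAt (jm C) (jd C p) p := by
  have h1 : HasDerivAt (fun r : ℝ => r ^ 2 / C ^ 2) (2 * p.1 / C ^ 2) p.1 := by
    simpa using (hasDerivAt_pow 2 p.1).div_const (C ^ 2)
  have h2 : HasDerivAt (fun r : ℝ => r / (2 * Real.pi)) (1 / (2 * Real.pi)) p.2 :=
    (hasDerivAt_id p.2).div_const _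
  exact HasFDerivAt.prodMap p h1.hasFDerivAt h2.hasFDerivAt

lemma jd_det (C : ℝ) (p : ℝ × ℝ) : (jd C p).det = p.1 * (1 / (C ^ 2 * Real.pi)) := by
  have : (jd C p).det = (2 * p.1 / C ^ 2) * (1 / (2 * Real.pi)) := by
    unfold jd ContinuousLinearMap.det
    rw [ContinuousLinearMap.coe_prodMap, LinearMap.det_prodMap]
    simp
  rw [this]
  field_simp

lemma nuM_preimage (C : ℝ) (hC : 0 < C) (E : Set ℂ) (hE : MeasurableSet E)
    (hb : E ⊆ Metric.closedBall 0 C) :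
    nuM (g C ⁻¹' E) = ENNReal.ofReal (1 / (C ^ 2 * Real.pi)) * volume E := by
  have hpi := Real.pi_pos
  have hgm : MeasurableSet (g C ⁻¹' E) := (g_cont C).measurable hE
  let P : ℝ × ℝ → ℂ := fun p => Complex.polarCoord.symm p
  have hPm : Measurable P := by
    have : Continuous P := by
      simp only [P, Complex.polarCoord_symm_apply]; fun_prop
    exact this.measurable
  let s : Set (ℝ × ℝ) := Set.Ioc 0 1 ×ˢ Set.Ioo (-(1/2)) (1/2)
  have hgj : ∀ p : ℝ × ℝ, 0 < p.1 → g C (jm C p) = P p := by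
    intro p hp
    simp only [g, jm, P, Complex.polarCoord_symm_apply]
    rw [Real.sqrt_div (by positivity), Real.sqrt_sq hp.le, Real.sqrt_sq hC.le,
      mul_div_cancel₀ _ hC.ne']
    congr 1
    rw [Complex.ofReal_cos, Complex.ofReal_sin, ← Complex.exp_mul_I]
    congr 1
    have : (Real.pi : ℂ) ≠ 0 := by exact_mod_cast hpi.ne'
    push_cast
    field_simp
  let T : Set (ℝ × ℝ) := polarCoord.target ∩ P ⁻¹' E
  have hTm : MeasurableSet T := polarCoord.open_target.measurableSet.inter (hPm hE)
  have hT : ∀ p ∈ T, 0 < p.1 ∧ p.1 ≤ C ∧ -Real.pi < p.2 ∧ p.2 < Real.pi := by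
    rintro ⟨r, φ⟩ ⟨h1, h2⟩
    rw [polarCoord_target] at h1
    have h3 := hb h2
    simp only [P, mem_closedBall_zero_iff, Complex.norm_polarCoord_symm] at h3
    exact ⟨h1.1, (le_abs_self _).trans h3, h1.2.1, h1.2.2⟩
  have himg : g C ⁻¹' E ∩ s = jm C '' T := by
    ext ⟨t, θ⟩
    constructor
    · rintro ⟨h1, ⟨⟨h2, h3⟩, h4, h5⟩⟩
      simp only at h2 h3 h4 h5
      have hs : 0 < Real.sqrt t := Real.sqrt_pos.2 h2
      have hj : jm C (C * Real.sqrt t, 2 * Real.pi * θ) = (t, θ) := by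
        simp only [jm, mul_pow, Real.sq_sqrt h2.le]
        ext <;> simp <;> field_simp
      refine ⟨(C * Real.sqrt t, 2 * Real.pi * θ), ⟨?_, ?_⟩, hj⟩
      · rw [polarCoord_target]
        refine ⟨mul_pos hC hs, ?_, ?_⟩ <;> simp only <;> nlinarith
      · show P _ ∈ E
        rw [← hgj _ (mul_pos hC hs), hj]
        exact h1
    · rintro ⟨p, hp, hpe⟩
      obtain ⟨h1, h2, h3, h4⟩ := hT p hp
      rw [← hpe]
      refine ⟨?_, ⟨?_, ?_⟩, ?_, ?_⟩
      · show g C (jm C p) ∈ E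
        rw [hgj p h1]; exact hp.2
      · simp only [jm]; positivity
      · simp only [jm]
        rw [div_le_one (by positivity)]
        gcongr
      · simp only [jm]
        rw [lt_div_iff₀ (by positivity)]; linarith
      · simp only [jm]
        rw [div_lt_iff₀ (by positivity)]; linarith
  have hinj : Set.InjOn (jm C) T := by
    rintro ⟨r, φ⟩ hp ⟨r', φ'⟩ hp' h
    obtain ⟨h1, -⟩ := hT _ hp
    obtain ⟨h1', -⟩ := hT _ hp'
    simp only [jm, Prod.mk.injEq] at h h1 h1'
    obtain ⟨h2, h3⟩ := h
    rw [div_left_inj' (by positivity)] at h2 h3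
    rw [pow_left_inj₀ h1.le h1'.le (by norm_num)] at h2
    rw [h2, h3]
  have hnu : nuM = (volume : Measure (ℝ × ℝ)).restrict s := by
    rw [nuM, Measure.restrict_congr_set (Ioo_ae_eq_Ico (μ := volume) (a := (-(1/2) : ℝ)) (b := 1/2)).symm, Measure.prod_restrict]
    rfl
  rw [hnu, Measure.restrict_apply hgm, himg,
    ← lintegral_abs_det_fderiv_eq_addHaar_image volume hTm
      (fun p _ => (jm_deriv C p).hasFDerivWithinAt) hinj]
  have hv : volume E = ∫⁻ p in T, ENNReal.ofReal p.1 := by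
    rw [← lintegral_indicator_one hE, ← Complex.lintegral_comp_polarCoord_symm]
    have : ∀ p : ℝ × ℝ, ENNReal.ofReal p.1 • E.indicator (1 : ℂ → ENNReal) (Complex.polarCoord.symm p)
        = (P ⁻¹' E).indicator (fun p => ENNReal.ofReal p.1) p := by
      intro p
      by_cases h : P p ∈ E
      · rw [Set.indicator_of_mem (show p ∈ P ⁻¹' E from h), Set.indicator_of_mem h]; simp
      · rw [Set.indicator_of_notMem (show p ∉ P ⁻¹' E from h), Set.indicator_of_notMem h]; simp
    simp_rw [this]
    rw [setLIntegral_indicator (hPm hE), Set.inter_comm]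
  rw [hv, ← lintegral_const_mul _ (by fun_prop)]
  refine setLIntegral_congr_fun hTm fun p hp => ?_
  rw [jd_det, abs_of_nonneg (mul_nonneg (hT p hp).1.le (by positivity)),
    ENNReal.ofReal_mul (hT p hp).1.le, mul_comm]

lemma zseq_eq (ξ : ℕ → ℝ) (C R : ℝ) (hC : 0 < C) (hR : 0 < R) (n : ℕ) :
    zseq ξ n = (R : ℂ) * g C ((n : ℝ) / (C ^ 2 * R ^ 2), th ξ n) := by
  simp only [g, zseq]
  rw [Real.sqrt_div (by positivity), ← mul_pow, Real.sqrt_sq (by positivity), ← mul_assoc]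
  have h1 : ((R : ℂ) * ((C * (Real.sqrt n / (C * R)) : ℝ) : ℂ)) = (Real.sqrt n : ℂ) := by
    rw [← Complex.ofReal_mul]
    congr 1
    field_simp
  rw [h1]
  congr 1
  rw [th_eq, Complex.exp_eq_exp_iff_exists_int]
  exact ⟨⌊ξ n + 1/2⌋, by push_cast; ring⟩

end UDD

/-- If `(ξ_n)` is uniformly distributed mod 1, then `(z_n)` has asymptotic density `π⁻¹`. -/
theorem unifDist_implies_density (ξ : ℕ → ℝ)
    (H : UnifDistMod1 ξ) :
    HasAsympDensity (zseq ξ) Real.pi⁻¹ := by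
  intro B hB hfr
  obtain ⟨C, hC, hBC⟩ := hB.subset_closedBall_lt 0 0
  have hcl : closure B ⊆ Metric.closedBall 0 C := closure_minimal hBC Metric.isClosed_closedBall
  have hnf : UDD.nuM (UDD.g C ⁻¹' (frontier B)) = 0 := by
    rw [UDD.nuM_preimage C hC _ isClosed_frontier.measurableSet (frontier_subset_closure.trans hcl),
      hfr, mul_zero]
  have hE : UDD.nuM (frontier (UDD.g C ⁻¹' B)) = 0 :=
    measure_mono_null ((UDD.g_cont C).frontier_preimage_subset B) hnf
  have hval : UDD.nuM (UDD.g C ⁻¹' B) = ENNReal.ofReal (1 / (C ^ 2 * Real.pi)) * volume B := by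
    have h1 : volume B = volume (closure B) :=
      (measure_closure_of_null_frontier hfr).symm
    rw [h1, ← UDD.nuM_preimage C hC _ isClosed_closure.measurableSet hcl]
    refine le_antisymm (measure_mono (Set.preimage_mono subset_closure)) ?_
    rw [closure_eq_self_union_frontier, Set.preimage_union]
    refine (measure_union_le _ _).trans ?_
    rw [hnf, add_zero]
  have hreal : UDD.nuM.real (UDD.g C ⁻¹' B) = 1 / (C ^ 2 * Real.pi) * (volume B).toReal := by
    rw [Measure.real, hval, ENNReal.toReal_mul, ENNReal.toReal_ofReal (by positivity)]
  have hx : Tendsto (fun R : ℝ => C ^ 2 * R ^ 2) atTop atTop :=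
    (tendsto_pow_atTop two_ne_zero).const_mul_atTop (by positivity)
  have h1 := ((UDD.count_tendsto ξ H _ hE).mul (tendsto_nat_floor_div_atTop (R := ℝ))).comp hx
  have h2 := h1.const_mul (C ^ 2)
  have h3 : C ^ 2 * (UDD.nuM.real (UDD.g C ⁻¹' B) * 1) = Real.pi⁻¹ * (volume B).toReal := by
    rw [hreal]
    have := Real.pi_pos
    field_simp
  rw [h3] at h2
  refine h2.congr' ?_
  filter_upwards [hx.eventually_ge_atTop 1, eventually_gt_atTop 0] with R hR1 hR
  have hset : {n : ℕ | 1 ≤ n ∧ zseq ξ n ∈ (fun w : ℂ => (R : ℂ) * w) '' B} =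
      {n : ℕ | 1 ≤ n ∧ n ≤ ⌊C ^ 2 * R ^ 2⌋₊ ∧
        ((n : ℝ) / (C ^ 2 * R ^ 2), UDD.th ξ n) ∈ UDD.g C ⁻¹' B} := by
    ext n
    have hRc : (R : ℂ) ≠ 0 := by exact_mod_cast hR.ne'
    have hm : zseq ξ n ∈ (fun w : ℂ => (R : ℂ) * w) '' B ↔
        UDD.g C ((n : ℝ) / (C ^ 2 * R ^ 2), UDD.th ξ n) ∈ B := by
      rw [UDD.zseq_eq ξ C R hC hR n]
      constructor
      · rintro ⟨w, hw, he⟩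
        rw [← mul_left_cancel₀ hRc he]; exact hw
      · intro h
        exact ⟨_, h, rfl⟩
    simp only [Set.mem_ofPred_eq, Set.mem_preimage, hm]
    constructor
    · rintro ⟨h1, h2⟩
      refine ⟨h1, ?_, h2⟩
      have h4 := hBC h2
      rw [mem_closedBall_zero_iff, UDD.g] at h4
      have he : ‖Complex.exp (2 * Real.pi * Complex.I * (UDD.th ξ n : ℂ))‖ = 1 := by
        rw [Complex.norm_exp]; simp
      rw [norm_mul, he, mul_one, Complex.norm_real, Real.norm_eq_abs,
        abs_of_nonneg (by positivity)] at h4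
      have h5 : Real.sqrt ((n : ℝ) / (C ^ 2 * R ^ 2)) ≤ 1 := by
        by_contra hcon
        nlinarith
      rw [Real.sqrt_le_one, div_le_one (by positivity)] at h5
      exact Nat.le_floor h5
    · rintro ⟨h1, _, h2⟩
      exact ⟨h1, h2⟩
  rw [hset]
  have hf : (⌊C ^ 2 * R ^ 2⌋₊ : ℝ) ≠ 0 := by
    have := Nat.floor_pos.2 hR1
    positivity
  simp only [Function.comp]
  field_simp
end

section
/- Let α > 0 and z_n = √n · e^{2πi α √n} ∈ ℂ for n ≥ 1. Then the sequence (z_n) has asymptotic density π⁻¹: for every bounded set B ⊆ ℂ whose topological boundary has Lebesgue measure zero, lim_{R→∞} #{n ∈ ℕ : z_n ∈ R·B}/R² = π⁻¹ · vol(B). -/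
open Filter Topology MeasureTheory

noncomputable def PP (s θ : ℝ) : ℂ := (s : ℂ) * Complex.exp (2 * Real.pi * Complex.I * (θ : ℂ))

lemma PP_cont : Continuous (fun p : ℝ × ℝ => PP p.1 p.2) := by
  unfold PP; fun_prop

lemma PP_cont' {X : Type*} [TopologicalSpace X] {a b : X → ℝ} (ha : Continuous a) (hb : Continuous b) :
    Continuous (fun x => PP (a x) (b x)) := PP_cont.comp (ha.prodMk hb)

lemma e_norm (θ : ℝ) : ‖Complex.exp (2 * Real.pi * Complex.I * (θ : ℂ))‖ = 1 := by
  have := Complex.norm_exp_ofReal_mul_I (2 * Real.pi * θ)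
  rw [← this]; congr 2; push_cast; ring

lemma PP_norm (s θ : ℝ) : ‖PP s θ‖ = |s| := by
  simp [PP, e_norm]

lemma PP_sub1 (s s' θ : ℝ) : ‖PP s θ - PP s' θ‖ = |s - s'| := by
  rw [← PP_norm (s - s') θ]; congr 1; simp [PP]; ring

lemma PP_sub2 (s θ θ' : ℝ) : ‖PP s θ - PP s θ'‖ ≤ |s| * (2 * Real.pi * |θ - θ'|) := by
  have h : PP s θ - PP s θ' = PP s θ' * (Complex.exp (Complex.I * ((2 * Real.pi * (θ - θ') : ℝ) : ℂ)) - 1) := by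
    simp only [PP]
    rw [mul_sub, mul_assoc (s : ℂ) _ (Complex.exp _), ← Complex.exp_add, mul_one]
    congr 3
    push_cast; ring
  rw [h, norm_mul, PP_norm]
  gcongr
  refine Real.norm_exp_I_mul_ofReal_sub_one_le.trans (le_of_eq ?_)
  rw [Real.norm_eq_abs, abs_mul, abs_of_pos (by positivity : 0 < 2 * Real.pi)]

lemma PP_per (s θ : ℝ) : PP s (θ + 1) = PP s θ := by
  simp only [PP]
  congr 1
  rw [← Complex.exp_periodic (2 * Real.pi * Complex.I * (θ : ℂ))]
  congr 1; push_cast; ring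

lemma sum_int (h : ℝ → ℝ) (hc : Continuous h) (ε : ℝ)
    (hh : ∀ (n : ℕ) (x : ℝ), n ≤ x → x ≤ n + 1 → |h (n + 1) - h x| ≤ ε) (N : ℕ) :
    |∑ n ∈ Finset.range N, h (n + 1) - ∫ x in (0:ℝ)..N, h x| ≤ N * ε := by
  induction N with
  | zero => simp
  | succ N ih =>
    rw [Finset.sum_range_succ, ← intervalIntegral.integral_add_adjacent_intervals (b := (N:ℝ))
      (hc.intervalIntegrable _ _) (hc.intervalIntegrable _ _)]
    have h1 : h (N + 1) - ∫ x in (N:ℝ)..(N + 1 : ℕ), h x = ∫ x in (N:ℝ)..(N + 1 : ℕ), (h (N + 1) - h x) := by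
      rw [intervalIntegral.integral_sub (by simp) (hc.intervalIntegrable _ _)]
      simp
    have h2 : |h (N + 1) - ∫ x in (N:ℝ)..(N + 1 : ℕ), h x| ≤ ε := by
      rw [h1]
      have := intervalIntegral.norm_integral_le_of_norm_le_const (a := (N:ℝ)) (b := (N + 1 : ℕ)) (C := ε) (f := fun x => h (N + 1) - h x) (by
        intro x hx
        rw [Set.uIoc_of_le (by push_cast; linarith)] at hx
        exact hh N x hx.1.le (by simpa using hx.2))
      simpa using this
    rw [abs_le] at *
    push_cast at *
    constructor <;> linarith

lemma swap_int (F : ℝ → ℝ → ℝ) (hF : Continuous (Function.uncurry F)) (a b c d : ℝ) :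
    ∫ s in a..b, ∫ u in c..d, F s u = ∫ u in c..d, ∫ s in a..b, F s u := by
  simp only [intervalIntegral.intervalIntegral_eq_integral_uIoc (a := c)]
  rw [← intervalIntegral_integral_swap]
  · split_ifs <;> simp
  · rw [Measure.prod_restrict]
    have : IntegrableOn (Function.uncurry F) (Set.uIcc a b ×ˢ Set.uIcc c d) :=
      hF.continuousOn.integrableOn_compact (isCompact_uIcc.prod isCompact_uIcc)
    exact this.mono_set (Set.prod_mono Set.uIoc_subset_uIcc Set.uIoc_subset_uIcc)

/-- oscillation lemma -/
lemma osc (g : ℂ → ℝ) (hg : Continuous g) (hu : UniformContinuous g) (h0 : g 0 = 0) (M : ℝ) (hM : 0 < M)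
    (hgM : ∀ w, M < ‖w‖ → g w = 0) :
    Tendsto (fun T : ℝ => ∫ s : ℝ, g (PP (max s 0) (T * s))) atTop
      (𝓝 (∫ s in (-1)..M, ∫ u in (0:ℝ)..1, g (PP (max s 0) u))) := by
  have hz : ∀ s θ, s ≤ 0 ∨ M < s → g (PP (max s 0) θ) = 0 := by
    rintro s θ (h | h)
    · simp [max_eq_right h, PP, h0]
    · apply hgM; rw [PP_norm, max_eq_left (by linarith), abs_of_pos (by linarith)]; exact h
  rw [Metric.tendsto_atTop]
  intro ε hε
  obtain ⟨δ, hδ, hδ'⟩ := Metric.uniformContinuous_iff.1 hu (ε / (2 * (M + 1))) (by positivity)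
  refine ⟨max 1 (2 / δ), fun T hT => ?_⟩
  have hT1 : 1 ≤ T := (le_max_left _ _).trans hT
  have hT2 : 2 / δ ≤ T := (le_max_right _ _).trans hT
  have hT0 : 0 < T := by linarith
  have hTδ : 1 / T < δ := by
    rw [div_le_iff₀ hδ] at hT2
    rw [div_lt_iff₀ hT0]; nlinarith
  have e1 : ∀ u ∈ Set.uIcc (0:ℝ) 1, ∫ s in (-1)..M, g (PP (max (s + u / T) 0) (T * s + u)) = ∫ s : ℝ, g (PP (max s 0) (T * s)) := by
    intro u hu
    rw [Set.uIcc_of_le zero_le_one] at hu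
    have hu' : 0 ≤ u / T := div_nonneg hu.1 hT0.le
    have hu'' : u / T ≤ 1 := by rw [div_le_one hT0]; linarith [hu.2]
    rw [← integral_add_right_eq_self _ (u / T), intervalIntegral.integral_eq_integral_of_support_subset]
    · congr 1; ext s; congr 2; field_simp
    · intro s hs
      by_contra hn
      apply hs
      apply hz
      rw [Set.mem_Ioc, not_and_or, not_lt, not_le] at hn
      rcases hn with hn | hn
      · left; linarith
      · right; linarith
  have c1 : Continuous (Function.uncurry fun u s : ℝ => g (PP (max (s + u / T) 0) (T * s + u))) := by
    apply hg.comp; apply PP_cont' <;> fun_prop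
  have c2 : Continuous (Function.uncurry fun u s : ℝ => g (PP (max s 0) (T * s + u))) := by
    apply hg.comp; apply PP_cont' <;> fun_prop
  have e2 : ∫ s : ℝ, g (PP (max s 0) (T * s)) = ∫ u in (0:ℝ)..1, ∫ s in (-1)..M, g (PP (max (s + u / T) 0) (T * s + u)) := by
    rw [intervalIntegral.integral_congr e1]; simp
  have e3 : ∫ s in (-1)..M, ∫ u in (0:ℝ)..1, g (PP (max s 0) u) = ∫ u in (0:ℝ)..1, ∫ s in (-1)..M, g (PP (max s 0) (T * s + u)) := by
    rw [swap_int _ c2]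
    apply intervalIntegral.integral_congr
    intro s _
    have hp : Function.Periodic (fun u => g (PP (max s 0) u)) 1 := fun u => by simp only [PP_per]
    have := hp.intervalIntegral_add_eq 0 (T * s)
    rw [zero_add] at this
    simp only
    rw [this, intervalIntegral.integral_comp_add_left (fun u => g (PP (max s 0) u))]
    simp
  rw [Real.dist_eq, e2, e3, ← intervalIntegral.integral_sub]
  rotate_left
  · exact (intervalIntegral.continuous_parametric_intervalIntegral_of_continuous' c1 _ _).intervalIntegrable _ _
  · exact (intervalIntegral.continuous_parametric_intervalIntegral_of_continuous' c2 _ _).intervalIntegrable _ _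
  have := intervalIntegral.norm_integral_le_of_norm_le_const (a := (0:ℝ)) (b := 1) (C := ε / 2) (f := fun u => (∫ s in (-1)..M, g (PP (max (s + u / T) 0) (T * s + u))) - ∫ s in (-1)..M, g (PP (max s 0) (T * s + u))) ?_
  · rw [Real.norm_eq_abs] at this
    norm_num at this
    linarith
  intro u hu
  rw [Set.uIoc_of_le zero_le_one] at hu
  rw [← intervalIntegral.integral_sub]
  rotate_left
  · apply Continuous.intervalIntegrable; apply hg.comp; apply PP_cont' <;> fun_prop
  · apply Continuous.intervalIntegrable; apply hg.comp; apply PP_cont' <;> fun_prop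
  refine (intervalIntegral.norm_integral_le_of_norm_le_const (C := ε / (2 * (M + 1))) ?_).trans ?_
  · intro s _
    rw [Real.norm_eq_abs, ← Real.dist_eq]
    apply le_of_lt; apply hδ'
    rw [dist_eq_norm, PP_sub1]
    refine lt_of_le_of_lt (abs_max_sub_max_le_abs _ _ _) ?_
    rw [add_sub_cancel_left, abs_of_nonneg (div_nonneg hu.1.le hT0.le)]
    refine lt_of_le_of_lt ?_ hTδ
    gcongr; exact hu.2
  · rw [abs_of_pos (by linarith)]
    apply le_of_eq; field_simp; ring

lemma polar (f : ℂ → ℝ) (hf : Continuous f) (M : ℝ) (hM : 0 < M)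
    (hfM : ∀ w, M < ‖w‖ → f w = 0) :
    ∫ s in (-1)..M, ∫ u in (0:ℝ)..1, (2 * ‖PP (max s 0) u‖ * f (PP (max s 0) u)) = Real.pi⁻¹ * ∫ w, f w := by
  have h1 : ∀ p : ℝ × ℝ, Complex.polarCoord.symm p = PP p.1 (p.2 / (2 * Real.pi)) := by
    intro p
    rw [Complex.polarCoord_symm_apply, PP]
    congr 1
    push_cast
    rw [← Complex.exp_mul_I]
    congr 1
    have : (Real.pi : ℂ) ≠ 0 := by exact_mod_cast Real.pi_ne_zero
    field_simp
  have cF : Continuous (fun p : ℝ × ℝ => p.1 • f (PP p.1 (p.2 / (2 * Real.pi)))) :=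
    continuous_fst.smul (hf.comp (PP_cont' (by fun_prop) (by fun_prop)))
  rw [← Complex.integral_comp_polarCoord_symm]
  simp only [h1]
  have h2 : ∫ p in polarCoord.target, p.1 • f (PP p.1 (p.2 / (2 * Real.pi))) =
     ∫ p in Set.Ioc 0 M ×ˢ Set.Ioo (-Real.pi) Real.pi, p.1 • f (PP p.1 (p.2 / (2 * Real.pi))) := by
    rw [polarCoord_target]
    apply setIntegral_eq_of_subset_of_forall_sdiff_eq_zero
    · exact measurableSet_Ioi.prod measurableSet_Ioo
    · exact Set.prod_mono Set.Ioc_subset_Ioi_self le_rfl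
    · rintro ⟨s, t⟩ ⟨⟨ha, hb⟩, hc⟩
      simp only [Set.mem_prod, Set.mem_Ioi, Set.mem_Ioc, not_and] at ha hb hc
      rw [hfM, smul_zero]
      rw [PP_norm, abs_of_pos ha]
      by_contra hh
      exact hc ⟨ha, not_lt.1 hh⟩ hb
  have h3 : ∀ s > 0, ∫ t in Set.Ioo (-Real.pi) Real.pi, s • f (PP s (t / (2 * Real.pi))) = Real.pi * ∫ u in (0:ℝ)..1, (2 * ‖PP (max s 0) u‖ * f (PP (max s 0) u)) := by
    intro s hs
    rw [← integral_Ioc_eq_integral_Ioo, ← intervalIntegral.integral_of_le (by linarith [Real.pi_pos])]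
    rw [intervalIntegral.integral_comp_div (fun u => s • f (PP s u)) (by positivity)]
    have hp : Function.Periodic (fun u => s • f (PP s u)) 1 := fun u => by simp only [PP_per]
    have := hp.intervalIntegral_add_eq 0 (-Real.pi / (2 * Real.pi))
    rw [show -Real.pi / (2 * Real.pi) + 1 = Real.pi / (2 * Real.pi) by field_simp; norm_num, zero_add] at this
    rw [← this, max_eq_left hs.le]
    simp only [PP_norm, abs_of_pos hs, smul_eq_mul, intervalIntegral.integral_const_mul]
    ring
  rw [h2, Measure.volume_eq_prod, setIntegral_prod]
  rotate_left
  · have : IntegrableOn (fun p : ℝ × ℝ => p.1 • f (PP p.1 (p.2 / (2 * Real.pi)))) (Set.Icc 0 M ×ˢ Set.Icc (-Real.pi) Real.pi) (volume.prod volume) :=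
      cF.continuousOn.integrableOn_compact (isCompact_Icc.prod isCompact_Icc)
    exact this.mono_set (Set.prod_mono Set.Ioc_subset_Icc_self Set.Ioo_subset_Icc_self)
  rw [setIntegral_congr_fun measurableSet_Ioc (fun s hs => h3 s hs.1), integral_const_mul, ← mul_assoc,
    inv_mul_cancel₀ Real.pi_ne_zero, one_mul, intervalIntegral.integral_of_le (by linarith)]
  apply setIntegral_eq_of_subset_of_forall_sdiff_eq_zero measurableSet_Ioc
  · exact Set.Ioc_subset_Ioc_left (by norm_num)
  · rintro s ⟨ha, hb⟩
    have : s ≤ 0 := by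
      by_contra hh; exact hb ⟨not_le.1 hh, ha.2⟩
    simp [PP_norm, max_eq_right this]

lemma riemann (α : ℝ) (hα : 0 < α) (f : ℂ → ℝ) (hf : Continuous f) (M : ℝ) (hM : 0 < M)
    (hfM : ∀ w, M < ‖w‖ → f w = 0) :
    Tendsto (fun R : ℝ => (∑ n ∈ Finset.range ⌈R ^ 2 * M ^ 2⌉₊,
      f ((R : ℂ)⁻¹ * PP (√((n:ℝ) + 1)) (α * √((n:ℝ) + 1)))) / R ^ 2) atTop
      (𝓝 (Real.pi⁻¹ * ∫ w, f w)) := by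
  have ucs : ∀ k : ℂ → ℝ, Continuous k → (∀ w, M < ‖w‖ → k w = 0) → UniformContinuous k := by
    intro k hk hk'
    refine HasCompactSupport.uniformContinuous_of_continuous ?_ hk
    refine HasCompactSupport.of_support_subset_isCompact (isCompact_closedBall (0:ℂ) M) ?_
    intro w hw
    rw [mem_closedBall_zero_iff]
    by_contra hh
    exact hw (hk' w (not_le.1 hh))
  have hgc : Continuous (fun w : ℂ => 2 * ‖w‖ * f w) := by fun_prop
  have hgM : ∀ w : ℂ, M < ‖w‖ → 2 * ‖w‖ * f w = 0 := fun w hw => by rw [hfM w hw, mul_zero]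
  have hosc := osc (fun w : ℂ => 2 * ‖w‖ * f w) hgc (ucs _ hgc hgM) (by simp) M hM hgM
  rw [polar f hf M hM hfM] at hosc
  have hosc2 := hosc.comp (tendsto_id.const_mul_atTop hα)
  refine (tendsto_of_tendsto_of_dist hosc2 ?_)
  rw [Metric.tendsto_atTop]
  intro ε hε
  have hfu := ucs f hf hfM
  obtain ⟨δ, hδ, hδ'⟩ := Metric.uniformContinuous_iff.1 hfu (ε / (2 * (M ^ 2 + 1))) (by positivity)
  set C : ℝ := 1 + 2 * Real.pi * α with hC
  have hCpos : 0 < C := by positivity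
  refine ⟨max 1 (2 * C / δ), fun R hR => ?_⟩
  have hR1 : 1 ≤ R := (le_max_left _ _).trans hR
  have hR2 : 2 * C / δ ≤ R := (le_max_right _ _).trans hR
  have hR0 : 0 < R := by linarith
  have hRδ : R⁻¹ * C < δ := by
    rw [div_le_iff₀ hδ] at hR2
    rw [inv_mul_lt_iff₀ hR0]; nlinarith
  set N := ⌈R ^ 2 * M ^ 2⌉₊ with hN
  have hN1 : R ^ 2 * M ^ 2 ≤ N := Nat.le_ceil _
  have hN2 : (N : ℝ) < R ^ 2 * M ^ 2 + 1 := Nat.ceil_lt_add_one (by positivity)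
  set h : ℝ → ℝ := fun x => f ((R : ℂ)⁻¹ * PP (√x) (α * √x)) with hh
  have hhc : Continuous h := by
    apply hf.comp
    exact continuous_const.mul (PP_cont' (by fun_prop) (by fun_prop))
  have hest : ∀ (n : ℕ) (x : ℝ), n ≤ x → x ≤ n + 1 → |h (n + 1) - h x| ≤ ε / (2 * (M ^ 2 + 1)) := by
    intro n x hx1 hx2
    rw [← Real.dist_eq]
    apply le_of_lt; apply hδ'
    have hx0 : 0 ≤ x := le_trans (Nat.cast_nonneg n) hx1
    rw [dist_eq_norm, ← mul_sub, norm_mul, norm_inv, Complex.norm_real, Real.norm_eq_abs, abs_of_pos hR0]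
    refine lt_of_le_of_lt ?_ hRδ
    gcongr
    set a := √((n:ℝ) + 1)
    set b := √x
    have hb0 : 0 ≤ b := Real.sqrt_nonneg _
    have hab : b ≤ a := Real.sqrt_le_sqrt hx2
    have ha2 : a ^ 2 = n + 1 := Real.sq_sqrt (by positivity)
    have hb2 : b ^ 2 = x := Real.sq_sqrt hx0
    have ha1 : 1 ≤ a := by
      rw [← Real.sqrt_one]; apply Real.sqrt_le_sqrt; have := Nat.cast_nonneg (α := ℝ) n; linarith
    have k1 : a - b ≤ 1 := by nlinarith
    have k2 : b * (a - b) ≤ 1 := by nlinarith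
    calc ‖PP a (α * a) - PP b (α * b)‖ = ‖(PP a (α * a) - PP b (α * a)) + (PP b (α * a) - PP b (α * b))‖ := by congr 1; ring
      _ ≤ |a - b| + |b| * (2 * Real.pi * |α * a - α * b|) := by
          refine (norm_add_le _ _).trans ?_
          rw [PP_sub1]
          gcongr
          exact PP_sub2 _ _ _
      _ = (a - b) + 2 * Real.pi * α * (b * (a - b)) := by
          rw [← mul_sub, abs_mul, abs_of_pos hα, abs_of_nonneg hb0, abs_of_nonneg (sub_nonneg.2 hab)]
          ring
      _ ≤ 1 + 2 * Real.pi * α * 1 := by gcongr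
      _ = C := by rw [hC]; ring
  have hsum := sum_int h hhc _ hest N
  have hint : ∫ x in (0:ℝ)..N, h x = R ^ 2 * ∫ s : ℝ, 2 * ‖PP (max s 0) (α * R * s)‖ * f (PP (max s 0) (α * R * s)) := by
    set b := √(N:ℝ) / R with hb
    have hb0 : 0 ≤ b := by positivity
    have hbM : M ≤ b := by
      rw [hb, le_div_iff₀ hR0]
      apply Real.le_sqrt_of_sq_le
      nlinarith
    have hbN : R ^ 2 * b ^ 2 = N := by
      rw [hb, div_pow, Real.sq_sqrt (Nat.cast_nonneg N)]; field_simp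
    have key := intervalIntegral.integral_comp_mul_deriv (a := 0) (b := b) (f := fun s => R ^ 2 * s ^ 2)
      (f' := fun s => R ^ 2 * (2 * s)) (g := h) (by
        intro s _
        have := ((hasDerivAt_id s).pow 2).const_mul (R ^ 2)
        simpa using this) (by fun_prop) hhc
    simp only [hbN] at key
    norm_num at key
    rw [← key, ← intervalIntegral.integral_eq_integral_of_support_subset (a := 0) (b := b), ← intervalIntegral.integral_const_mul]
    · apply intervalIntegral.integral_congr
      intro s hs
      rw [Set.uIcc_of_le hb0] at hs
      have hsq : √(R ^ 2 * s ^ 2) = R * s := by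
        rw [← mul_pow, Real.sqrt_sq (mul_nonneg hR0.le hs.1)]
      have hPP : (R : ℂ)⁻¹ * PP (R * s) (α * (R * s)) = PP s (α * R * s) := by
        have : (R : ℂ) ≠ 0 := by exact_mod_cast hR0.ne'
        simp only [PP]; rw [mul_assoc α R s]; push_cast; field_simp
      simp only [hh, hsq, hPP, max_eq_left hs.1, PP_norm, abs_of_nonneg hs.1]
      ring
    · intro s hs
      by_contra hn
      apply hs
      rw [Set.mem_Ioc, not_and_or, not_lt, not_le] at hn
      rcases hn with hn | hn
      · simp [PP_norm, max_eq_right hn]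
      · simp only
        rw [hfM, mul_zero]
        rw [PP_norm, max_eq_left (by linarith), abs_of_pos (by linarith)]; linarith
  rw [hint] at hsum
  rw [dist_zero_right, Real.norm_of_nonneg dist_nonneg, dist_comm, Real.dist_eq]
  simp only [Function.comp, id]
  have hR2pos : 0 < R ^ 2 := by positivity
  have : (∑ n ∈ Finset.range N, h (n + 1)) / R ^ 2 - ∫ s : ℝ, 2 * ‖PP (max s 0) (α * R * s)‖ * f (PP (max s 0) (α * R * s)) = (∑ n ∈ Finset.range N, h (n + 1) - R ^ 2 * ∫ s : ℝ, 2 * ‖PP (max s 0) (α * R * s)‖ * f (PP (max s 0) (α * R * s))) / R ^ 2 := by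
    field_simp
  rw [this, abs_div, abs_of_pos hR2pos, div_lt_iff₀ hR2pos]
  refine lt_of_le_of_lt hsum ?_
  have hR2' : 1 ≤ R ^ 2 := by nlinarith
  calc (N:ℝ) * (ε / (2 * (M ^ 2 + 1))) ≤ (R ^ 2 * (M ^ 2 + 1)) * (ε / (2 * (M ^ 2 + 1))) := by
        gcongr; nlinarith
    _ = (ε / 2) * R ^ 2 := by field_simp
    _ < ε * R ^ 2 := by nlinarith

lemma count_eq (α : ℝ) (B : Set ℂ) (M : ℝ) (hB : B ⊆ Metric.closedBall 0 M) (R : ℝ) (hR : 0 < R) :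
    ({n : ℕ | 1 ≤ n ∧ zseq (fun k => α * Real.sqrt k) n ∈ (fun w : ℂ => (R : ℂ) * w) '' B}.ncard : ℝ) =
    ∑ n ∈ Finset.range ⌈R ^ 2 * M ^ 2⌉₊, B.indicator (fun _ => (1:ℝ))
      ((R : ℂ)⁻¹ * PP (√((n:ℝ) + 1)) (α * √((n:ℝ) + 1))) := by
  classical
  have hR' : (R : ℂ) ≠ 0 := by exact_mod_cast hR.ne'
  have hz : ∀ n : ℕ, zseq (fun k => α * Real.sqrt k) (n + 1) = PP (√((n:ℝ) + 1)) (α * √((n:ℝ) + 1)) := by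
    intro n; simp [zseq, PP]
  have hset : {n : ℕ | 1 ≤ n ∧ zseq (fun k => α * Real.sqrt k) n ∈ (fun w : ℂ => (R : ℂ) * w) '' B} =
      (((Finset.range ⌈R ^ 2 * M ^ 2⌉₊).filter (fun n : ℕ => (R : ℂ)⁻¹ * PP (√((n:ℝ) + 1)) (α * √((n:ℝ) + 1)) ∈ B)).image Nat.succ : Finset ℕ) := by
    ext m
    simp only [Set.mem_ofPred_eq, Finset.coe_image, Set.mem_image, Finset.mem_coe, Finset.mem_filter, Finset.mem_range]
    constructor
    · rintro ⟨hm, w, hw, hw'⟩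
      obtain ⟨n, rfl⟩ : ∃ n, m = n + 1 := ⟨m - 1, by omega⟩
      have hw2 : (R : ℂ)⁻¹ * PP (√((n:ℝ) + 1)) (α * √((n:ℝ) + 1)) = w := by
        rw [← hz, ← hw']; field_simp
      refine ⟨n, ⟨?_, by rw [hw2]; exact hw⟩, rfl⟩
      have hb := hB hw
      rw [mem_closedBall_zero_iff, ← hw2, norm_mul, norm_inv, Complex.norm_real, Real.norm_eq_abs, abs_of_pos hR,
        PP_norm, abs_of_nonneg (Real.sqrt_nonneg _), inv_mul_le_iff₀ hR] at hb
      rw [Nat.lt_ceil, ← mul_pow]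
      have := Real.sq_sqrt (show (0:ℝ) ≤ n + 1 by positivity)
      have h0 := Real.sqrt_nonneg ((n:ℝ) + 1)
      nlinarith
    · rintro ⟨n, ⟨_, hn⟩, rfl⟩
      refine ⟨by omega, _, hn, ?_⟩
      simp only [Nat.succ_eq_add_one]
      rw [hz]; field_simp
  rw [hset, Set.ncard_coe_finset, Finset.card_image_of_injective _ Nat.succ_injective, Finset.card_filter]
  push_cast
  rfl

/-- For any `α > 0`, the sequence `z_n = √n · e^{2πiα√n}` has asymptotic density `π⁻¹`. -/
theorem density_sqrt (α : ℝ) (hα : 0 < α) :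
    HasAsympDensity (zseq (fun k => α * Real.sqrt k)) Real.pi⁻¹ := by
  intro B hB hfr
  obtain ⟨M, hM, hBM⟩ : ∃ M : ℝ, 0 < M ∧ closure B ⊆ Metric.ball 0 M := by
    obtain ⟨r, hr⟩ := hB.closure.subset_ball 0
    exact ⟨max r 1, by positivity, hr.trans (Metric.ball_subset_ball (le_max_left _ _))⟩
  have hBM' : B ⊆ Metric.closedBall 0 M := (subset_closure.trans hBM).trans Metric.ball_subset_closedBall
  have hcl : volume (closure B) = volume B := by
    apply le_antisymm _ (measure_mono subset_closure)
    rw [closure_eq_self_union_frontier]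
    exact (measure_union_le _ _).trans (by simp [hfr])
  have hin : volume (interior B) = volume B := by
    apply le_antisymm (measure_mono interior_subset)
    rw [← hcl, closure_eq_interior_union_frontier]
    exact (measure_union_le _ _).trans (by simp [hfr])
  have hfin : volume B ≠ ⊤ := hB.measure_lt_top.ne
  have hcomp : IsCompact (closure B) := hB.isCompact_closure
  have hvan : ∀ f : ℂ → ℝ, (∀ w, w ∉ Metric.ball (0:ℂ) M → f w = 0) → ∀ w, M < ‖w‖ → f w = 0 := by
    intro f hf w hw
    apply hf; rw [mem_ball_zero_iff]; exact not_lt.2 hw.le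
  rw [tendsto_order]
  have hpi := Real.pi_pos
  constructor
  · intro c hc
    -- compact subset of the interior
    have hc' : Real.pi * c < (volume B).toReal := by
      rwa [lt_inv_mul_iff₀ hpi] at hc
    obtain ⟨K, hKs, hK, hKv⟩ : ∃ K ⊆ interior B, IsCompact K ∧ Real.pi * c < (volume K).toReal := by
      rcases lt_or_ge (Real.pi * c) 0 with hneg | hpos
      · exact ⟨∅, by simp, isCompact_empty, by simpa using hneg⟩
      · have : ENNReal.ofReal (Real.pi * c) < volume (interior B) := by
          rw [hin]; exact (ENNReal.ofReal_lt_iff_lt_toReal hpos hfin).2 hc'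
        obtain ⟨K, h1, h2, h3⟩ := isOpen_interior.exists_lt_isCompact this
        exact ⟨K, h1, h2, (ENNReal.ofReal_lt_iff_lt_toReal hpos h2.measure_lt_top.ne).1 h3⟩
    obtain ⟨f, hf1, hf0, -, hf01⟩ := exists_continuous_one_zero_of_isCompact hK
      (isOpen_interior (s := B)).isClosed_compl (Set.disjoint_compl_right_iff_subset.2 hKs)
    have hfM := hvan f (fun w hw => hf0 (fun hw' => hw (hBM (subset_closure (interior_subset hw')))))
    have hlim := riemann α hα f f.continuous M hM hfM
    have hfint : (volume K).toReal ≤ ∫ w, f w := by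
      have hfi : Integrable f := f.continuous.integrable_of_hasCompactSupport
        (HasCompactSupport.of_support_subset_isCompact (isCompact_closedBall (0:ℂ) M) (fun w hw => by
          rw [mem_closedBall_zero_iff]; by_contra hh; exact hw (hfM w (not_le.1 hh))))
      calc (volume K).toReal = ∫ w, K.indicator (fun _ => (1:ℝ)) w := by
            rw [integral_indicator hK.measurableSet]; simp [Measure.real]
        _ ≤ ∫ w, f w := by
            apply integral_mono _ hfi
            · intro w
              by_cases hw : w ∈ K
              · simp [hw, hf1 hw]
              · simp [hw, (hf01 w).1]
            · exact (integrable_indicator_iff hK.measurableSet).2 (integrableOn_const hK.measure_lt_top.ne)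
    have hlt : c < Real.pi⁻¹ * ∫ w, f w := by
      rw [lt_inv_mul_iff₀ hpi]; linarith
    filter_upwards [hlim.eventually (lt_mem_nhds hlt), eventually_gt_atTop 0] with R h1 hR
    refine h1.trans_le ?_
    rw [count_eq α B M hBM' R hR]
    gcongr with n hn
    by_cases hw : (R : ℂ)⁻¹ * PP (√((n:ℝ) + 1)) (α * √((n:ℝ) + 1)) ∈ B
    · simp [hw, (hf01 _).2]
    · rw [hf0 (fun h => hw (interior_subset h))]; simp [hw]
  · intro c hc
    have hc' : (volume B).toReal < Real.pi * c := by
      rwa [gt_iff_lt, inv_mul_lt_iff₀ hpi] at hc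
    have hpos : 0 ≤ Real.pi * c := ENNReal.toReal_nonneg.trans hc'.le
    obtain ⟨U, hUs, hU, hUv⟩ : ∃ U, closure B ⊆ U ∧ IsOpen U ∧ volume U < ENNReal.ofReal (Real.pi * c) := by
      apply (closure B).exists_isOpen_lt_of_lt
      rw [hcl]; exact (ENNReal.lt_ofReal_iff_toReal_lt hfin).2 hc'
    set V := U ∩ Metric.ball 0 M with hV
    have hVo : IsOpen V := hU.inter Metric.isOpen_ball
    have hVv : (volume V).toReal < Real.pi * c := by
      have := (measure_mono Set.inter_subset_left : volume V ≤ volume U).trans_lt hUv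
      exact (ENNReal.lt_ofReal_iff_toReal_lt this.ne_top).1 this
    have hVt : volume V ≠ ⊤ := ((measure_mono Set.inter_subset_left : volume V ≤ volume U).trans_lt hUv).ne_top
    obtain ⟨f, hf1, hf0, -, hf01⟩ := exists_continuous_one_zero_of_isCompact hcomp
      hVo.isClosed_compl (Set.disjoint_compl_right_iff_subset.2 (Set.subset_inter hUs hBM))
    have hfM := hvan f (fun w hw => hf0 (fun hw' => hw hw'.2))
    have hlim := riemann α hα f f.continuous M hM hfM
    have hfint : ∫ w, f w ≤ (volume V).toReal := by
      have hfi : Integrable f := f.continuous.integrable_of_hasCompactSupport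
        (HasCompactSupport.of_support_subset_isCompact (isCompact_closedBall (0:ℂ) M) (fun w hw => by
          rw [mem_closedBall_zero_iff]; by_contra hh; exact hw (hfM w (not_le.1 hh))))
      calc ∫ w, f w ≤ ∫ w, V.indicator (fun _ => (1:ℝ)) w := by
            apply integral_mono hfi
            · exact (integrable_indicator_iff hVo.measurableSet).2 (integrableOn_const hVt)
            · intro w
              by_cases hw : w ∈ V
              · simp [hw, (hf01 w).2]
              · simp [hw, hf0 hw]
        _ = (volume V).toReal := by
            rw [integral_indicator hVo.measurableSet]; simp [Measure.real]
    have hlt : Real.pi⁻¹ * ∫ w, f w < c := by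
      rw [inv_mul_lt_iff₀ hpi]; linarith
    filter_upwards [hlim.eventually (gt_mem_nhds hlt), eventually_gt_atTop 0] with R h1 hR
    refine lt_of_le_of_lt ?_ h1
    rw [count_eq α B M hBM' R hR]
    gcongr with n hn
    by_cases hw : (R : ℂ)⁻¹ * PP (√((n:ℝ) + 1)) (α * √((n:ℝ) + 1)) ∈ B
    · rw [hf1 (subset_closure hw)]; simp [hw]
    · simp [hw, (hf01 _).1]
end
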